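/- Let K be an infinite field, n ≥ 4 and m ≥ 1 integers, and p(x_1,...,x_m) a noncommutative polynomial with zero constant term over K of order n − 2. Then p(T_n(K)) = T_n(K)^{(n−3)}, i.e., the image of p on T_n(K) is exactly the set of upper triangular matrices whose (i,j) entries vanish for j − i ≤ n − 3. -/

import Mathlib

/-- `A` is upper triangular. -/
def UT {K : Type*} [Field K] {n : ℕ} (A : Matrix (Fin n) (Fin n) K) : Prop :=
  ∀ i j : Fin n, (j : ℕ) < (i : ℕ) → A i j = 0

/-- `p` has zero constant term. -/
def ZeroConst {K : Type*} [Field K] {m : ℕ} (p : FreeAlgebra K (Fin m)) : Prop :=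
  FreeAlgebra.lift K (fun _ : Fin m => (0 : K)) p = 0

/-- `p` has order `r`: it vanishes on all upper triangular `r × r` matrices but not on
all upper triangular `(r+1) × (r+1)` matrices. -/
def HasOrder {K : Type*} [Field K] {m : ℕ} (p : FreeAlgebra K (Fin m)) (r : ℕ) : Prop :=
  (∀ u : Fin m → Matrix (Fin r) (Fin r) K, (∀ i, UT (u i)) →
      FreeAlgebra.lift K u p = 0) ∧
  ∃ u : Fin m → Matrix (Fin (r + 1)) (Fin (r + 1)) K, (∀ i, UT (u i)) ∧
      FreeAlgebra.lift K u p ≠ 0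

/-- A relation between two `K`-algebras that respects the operations and relates the generators
relates the values of every noncommutative polynomial. -/
theorem lift_rel {K : Type*} [Field K] {X S T : Type*} [Ring S] [Algebra K S] [Ring T]
    [Algebra K T] (R : S → T → Prop)
    (hc : ∀ c : K, R (algebraMap K S c) (algebraMap K T c))
    (hadd : ∀ a b a' b', R a b → R a' b' → R (a + a') (b + b'))
    (hmul : ∀ a b a' b', R a b → R a' b' → R (a * a') (b * b'))
    {u : X → S} {v : X → T} (huv : ∀ i, R (u i) (v i)) (p : FreeAlgebra K X) :
    R (FreeAlgebra.lift K u p) (FreeAlgebra.lift K v p) := by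
  induction p using FreeAlgebra.induction with
  | grade0 c => simpa using hc c
  | grade1 i => simpa using huv i
  | mul a b ha hb => simpa using hmul _ _ _ _ ha hb
  | add a b ha hb => simpa using hadd _ _ _ _ ha hb

section UpperTriangular

variable {K : Type*} [Field K] {n : ℕ}

theorem UT.algebraMap (c : K) : UT (algebraMap K (Matrix (Fin n) (Fin n) K) c) := by
  intro i j h
  rw [Matrix.algebraMap_matrix_apply, if_neg (by rintro rfl; omega)]

theorem UT.add {A B : Matrix (Fin n) (Fin n) K} (hA : UT A) (hB : UT B) : UT (A + B) := by
  intro i j h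
  simp [hA i j h, hB i j h]

theorem UT.mul {A B : Matrix (Fin n) (Fin n) K} (hA : UT A) (hB : UT B) : UT (A * B) := by
  intro i j h
  rw [Matrix.mul_apply]
  refine Finset.sum_eq_zero fun k _ => ?_
  rcases lt_or_ge (k : ℕ) i with hk | hk
  · rw [hA i k hk, zero_mul]
  · rw [hB k j (by omega), mul_zero]

theorem UT.transvection {i j : Fin n} (hij : i < j) (c : K) : UT (Matrix.transvection i j c) := by
  intro k l h
  rw [Matrix.transvection, Matrix.add_apply, Matrix.one_apply_ne (by rintro rfl; omega),
    Matrix.single_apply_of_ne, add_zero]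
  rintro ⟨rfl, rfl⟩
  omega

theorem UT.lift {X : Type*} {u : X → Matrix (Fin n) (Fin n) K} (hu : ∀ i, UT (u i))
    (p : FreeAlgebra K X) : UT (FreeAlgebra.lift K u p) :=
  lift_rel (fun A _ => UT A) UT.algebraMap (fun _ _ _ _ h h' => h.add h')
    (fun _ _ _ _ h h' => h.mul h') (v := u) hu p

theorem submatrix_mul_of_forall {r : ℕ} {e : Fin r → Fin n} (he : Function.Injective e)
    {A B : Matrix (Fin n) (Fin n) K}
    (h : ∀ i j, ∀ k ∉ Set.range e, A (e i) k * B k (e j) = 0) :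
    (A * B).submatrix e e = A.submatrix e e * B.submatrix e e := by
  ext i j
  simp only [Matrix.submatrix_apply, Matrix.mul_apply]
  exact (Fintype.sum_of_injective e he _ _ (fun k hk => h i j k hk) fun _ => rfl).symm

theorem submatrix_algebraMap {r : ℕ} {e : Fin r → Fin n} (he : Function.Injective e) (c : K) :
    (algebraMap K (Matrix (Fin n) (Fin n) K) c).submatrix e e =
      algebraMap K (Matrix (Fin r) (Fin r) K) c := by
  ext i j
  simp [Matrix.algebraMap_matrix_apply, he.eq_iff]

/-- Restriction to a window of consecutive indices commutes with evaluation on upper triangular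
matrices. -/
theorem lift_submatrix_window {X : Type*} {r : ℕ} {e : Fin r → Fin n} (s : ℕ)
    (he : ∀ k, (e k : ℕ) = s + k) {u : X → Matrix (Fin n) (Fin n) K} (hu : ∀ i, UT (u i))
    (p : FreeAlgebra K X) :
    FreeAlgebra.lift K (fun i => (u i).submatrix e e) p =
      (FreeAlgebra.lift K u p).submatrix e e := by
  have hinj : Function.Injective e := fun a b hab => by
    have := he a
    have := he b
    rw [hab] at *
    ext
    omega
  refine (lift_rel (fun A B => UT A ∧ B = A.submatrix e e)
    (fun c => ⟨UT.algebraMap c, (submatrix_algebraMap hinj c).symm⟩) ?_ ?_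
    (fun i => ⟨hu i, rfl⟩) p).2
  · rintro A _ B _ ⟨hA, rfl⟩ ⟨hB, rfl⟩
    exact ⟨hA.add hB, rfl⟩
  · rintro A _ B _ ⟨hA, rfl⟩ ⟨hB, rfl⟩
    refine ⟨hA.mul hB, (submatrix_mul_of_forall hinj fun i j k hk => ?_).symm⟩
    have hi := he i
    have hj := he j
    rcases lt_or_ge (k : ℕ) s with hks | hks
    · rw [hA _ _ (by omega), zero_mul]
    · have : s + r ≤ k := by
        by_contra! hlt
        exact hk ⟨⟨k - s, by omega⟩, by ext; rw [he]; simp; omega⟩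
      rw [hB _ _ (by omega), mul_zero]

/-- Entrywise scaling by multiplicative weights commutes with evaluation on upper triangular
matrices. -/
theorem lift_weight {X : Type*} (w : Fin n → Fin n → K) (hw : ∀ i, w i i = 1)
    (hmul : ∀ i k j, i ≤ k → k ≤ j → w i k * w k j = w i j)
    {u : X → Matrix (Fin n) (Fin n) K} (hu : ∀ i, UT (u i)) (p : FreeAlgebra K X) :
    FreeAlgebra.lift K (fun l => Matrix.of fun i j => w i j * u l i j) p =
      Matrix.of fun i j => w i j * FreeAlgebra.lift K u p i j := by
  refine (lift_rel (fun A B => UT A ∧ B = Matrix.of fun i j => w i j * A i j)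
    (fun c => ⟨UT.algebraMap c, ?_⟩) ?_ ?_ (fun i => ⟨hu i, rfl⟩) p).2
  · ext i j
    by_cases h : i = j
    · subst h
      simp [hw]
    · simp [Matrix.algebraMap_matrix_apply, h]
  · rintro A _ B _ ⟨hA, rfl⟩ ⟨hB, rfl⟩
    refine ⟨hA.add hB, ?_⟩
    ext i j
    simp [mul_add]
  · rintro A _ B _ ⟨hA, rfl⟩ ⟨hB, rfl⟩
    refine ⟨hA.mul hB, ?_⟩
    ext i j
    simp only [Matrix.mul_apply, Matrix.of_apply, Finset.mul_sum]
    refine Finset.sum_congr rfl fun k _ => ?_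
    rcases lt_or_ge k i with hk | hk
    · simp [hA i k hk]
    rcases lt_or_ge j k with hj | hj
    · simp [hB k j hj]
    rw [← hmul i k j hk hj]
    ring

theorem lift_conj {X : Type*} {g g' : Matrix (Fin n) (Fin n) K} (h : g * g' = 1)
    (u : X → Matrix (Fin n) (Fin n) K) (p : FreeAlgebra K X) :
    FreeAlgebra.lift K (fun i => g * u i * g') p = g * FreeAlgebra.lift K u p * g' := by
  have h' : g' * g = 1 := mul_eq_one_comm.mp h
  refine lift_rel (fun A B => B = g * A * g') (fun c => ?_) ?_ ?_ (fun i => rfl) p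
  · rw [← Algebra.commutes, mul_assoc, h, mul_one]
  · rintro A _ B _ rfl rfl
    rw [mul_add, add_mul]
  · rintro A _ B _ rfl rfl
    calc g * A * g' * (g * B * g') = g * A * (g' * g) * B * g' := by simp only [mul_assoc]
      _ = g * (A * B) * g' := by rw [h', mul_one]; simp only [mul_assoc]

/-- Values of `p` on matrices in which the index `k` is isolated restrict to the values on the
remaining indices, and `k` stays isolated. -/
theorem lift_succAbove {X : Type*} (k : Fin (n + 1))
    {u : X → Matrix (Fin (n + 1)) (Fin (n + 1)) K}
    (hrow : ∀ l, ∀ j ≠ k, u l k j = 0) (hcol : ∀ l, ∀ i ≠ k, u l i k = 0)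
    (p : FreeAlgebra K X) :
    (∀ j ≠ k, FreeAlgebra.lift K u p k j = 0) ∧ (∀ i ≠ k, FreeAlgebra.lift K u p i k = 0) ∧
      FreeAlgebra.lift K (fun l => (u l).submatrix k.succAbove k.succAbove) p =
        (FreeAlgebra.lift K u p).submatrix k.succAbove k.succAbove := by
  have hinj : Function.Injective k.succAbove := Fin.succAbove_right_injective
  refine lift_rel (fun (A : Matrix (Fin (n + 1)) (Fin (n + 1)) K) B =>
    (∀ j ≠ k, A k j = 0) ∧ (∀ i ≠ k, A i k = 0) ∧ B = A.submatrix k.succAbove k.succAbove) (fun c => ⟨fun j hj => ?_, fun i hi => ?_,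
      (submatrix_algebraMap hinj c).symm⟩) ?_ ?_ (fun l => ⟨hrow l, hcol l, rfl⟩) p
  · simp [Matrix.algebraMap_matrix_apply, hj.symm]
  · simp [Matrix.algebraMap_matrix_apply, hi]
  · rintro A _ B _ ⟨hA, hA', rfl⟩ ⟨hB, hB', rfl⟩
    exact ⟨fun j hj => by simp [hA j hj, hB j hj], fun i hi => by simp [hA' i hi, hB' i hi], rfl⟩
  · rintro A _ B _ ⟨hA, hA', rfl⟩ ⟨hB, hB', rfl⟩
    refine ⟨fun j hj => ?_, fun i hi => ?_,
      (submatrix_mul_of_forall hinj fun i j l hl => ?_).symm⟩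
    · rw [Matrix.mul_apply]
      refine Finset.sum_eq_zero fun l _ => ?_
      by_cases hl : l = k
      · rw [hl, hB j hj, mul_zero]
      · rw [hA l hl, zero_mul]
    · rw [Matrix.mul_apply]
      refine Finset.sum_eq_zero fun l _ => ?_
      by_cases hl : l = k
      · rw [hl, hA' i hi, zero_mul]
      · rw [hB' l hl, mul_zero]
    · rw [Fin.range_succAbove, Set.mem_compl_iff, not_not, Set.mem_singleton_iff] at hl
      rw [hl, hA' _ (Fin.succAbove_ne k i), zero_mul]

/-- The upper triangular matrices with the entries on and above the diagonal prescribed. -/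
def upperTriangularOf {X R : Type*} [Zero R] (c : X × Fin n × Fin n → R) (l : X) :
    Matrix (Fin n) (Fin n) R :=
  Matrix.of fun i j => if i ≤ j then c (l, i, j) else 0

theorem UT_upperTriangularOf {X : Type*} (c : X × Fin n × Fin n → K) (l : X) :
    UT (upperTriangularOf c l) := by
  intro i j h
  exact if_neg (not_le.mpr (Fin.lt_def.mpr h))

/-- The entries of a value of `p` on upper triangular matrices are polynomial in the entries of
the arguments. -/
theorem exists_eval_eq_lift {X : Type*} (p : FreeAlgebra K X) (i j : Fin n) :
    ∃ Q : MvPolynomial (X × Fin n × Fin n) K, ∀ c,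
      MvPolynomial.eval c Q = FreeAlgebra.lift K (upperTriangularOf c) p i j := by
  refine ⟨FreeAlgebra.lift K
    (upperTriangularOf (MvPolynomial.X : X × Fin n × Fin n → MvPolynomial _ K)) p i j,
    fun c => ?_⟩
  have h := lift_rel (fun (A : Matrix (Fin n) (Fin n) (MvPolynomial (X × Fin n × Fin n) K))
      (B : Matrix (Fin n) (Fin n) K) => B = (MvPolynomial.aeval c).mapMatrix A)
    (u := upperTriangularOf MvPolynomial.X) (v := upperTriangularOf c)
    (fun a => (AlgHom.commutes _ a).symm) ?_ ?_ ?_ p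
  · rw [h]
    simp [MvPolynomial.aeval_eq_eval]
  · rintro A _ B _ rfl rfl
    rw [map_add]
  · rintro A _ B _ rfl rfl
    rw [map_mul]
  · intro l
    ext a b
    by_cases hab : a ≤ b <;> simp [upperTriangularOf, hab]

end UpperTriangular

section Order

variable {K : Type*} [Field K] {m r : ℕ} {p : FreeAlgebra K (Fin m)}

theorem HasOrder.lift_apply_eq_zero (hord : HasOrder p r) {n : ℕ} (hn : r ≤ n)
    {u : Fin m → Matrix (Fin n) (Fin n) K} (hu : ∀ i, UT (u i)) {i j : Fin n}
    (hij : (j : ℕ) < i + r) : FreeAlgebra.lift K u p i j = 0 := by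
  rcases lt_or_ge (j : ℕ) i with hlt | hle
  · exact UT.lift hu p i j hlt
  obtain ⟨s, hsi, hsn, hjs⟩ : ∃ s : ℕ, s ≤ i ∧ s + r ≤ n ∧ (j : ℕ) < s + r :=
    ⟨min i (n - r), by omega, by omega, by omega⟩
  let e : Fin r → Fin n := fun k => ⟨s + k, by omega⟩
  have h := lift_submatrix_window (e := e) s (fun _ => rfl) hu p
  rw [hord.1 (fun l => (u l).submatrix e e) fun l a b hab =>
    hu l (e a) (e b) (by simp only [e]; omega)] at h
  have h' := congrFun₂ h ⟨i - s, by omega⟩ ⟨j - s, by omega⟩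
  simp only [Matrix.zero_apply, Matrix.submatrix_apply, e] at h'
  convert h'.symm using 2 <;> ext <;> simp <;> omega

theorem HasOrder.exists_corner_ne_zero (hord : HasOrder p r) :
    ∃ u : Fin m → Matrix (Fin (r + 1)) (Fin (r + 1)) K, (∀ i, UT (u i)) ∧
      FreeAlgebra.lift K u p 0 (Fin.last r) ≠ 0 := by
  obtain ⟨u, hu, hne⟩ := hord.2
  refine ⟨u, hu, fun h => hne ?_⟩
  ext i j
  by_cases hij : (j : ℕ) < i + r
  · exact hord.lift_apply_eq_zero (by omega) hu hij
  · have hj := j.isLt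
    obtain rfl : i = 0 := by ext; simp only [Fin.val_zero]; omega
    obtain rfl : j = Fin.last r := by ext; simp at hij ⊢; omega
    simpa using h

theorem HasOrder.exists_both_ne_zero [Infinite K] (hord : HasOrder p r) :
    ∃ u : Fin m → Matrix (Fin (r + 2)) (Fin (r + 2)) K, (∀ i, UT (u i)) ∧
      FreeAlgebra.lift K u p 0 (Fin.last r).castSucc ≠ 0 ∧
      FreeAlgebra.lift K u p 1 (Fin.last (r + 1)) ≠ 0 := by
  obtain ⟨v, hv, hne⟩ := hord.exists_corner_ne_zero
  obtain ⟨Q, hQ⟩ := exists_eval_eq_lift p 0 (Fin.last r)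
  have hQ0 : Q ≠ 0 := by
    rintro rfl
    refine hne ?_
    have h := hQ fun x => v x.1 x.2.1 x.2.2
    rw [map_zero] at h
    rw [h]
    suffices upperTriangularOf (fun x => v x.1 x.2.1 x.2.2) = v by rw [this]
    ext l i j
    rcases le_or_gt i j with hij | hij
    · simp [upperTriangularOf, hij]
    · simp [upperTriangularOf, not_le.mpr hij, hv l i j hij]
  have hren : ∀ e : Fin (r + 1) → Fin (r + 2), Function.Injective e →
      MvPolynomial.rename (Prod.map id (Prod.map e e)) Q ≠ 0 := fun e he h =>
    hQ0 (MvPolynomial.rename_injective _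
      (Function.injective_id.prodMap (he.prodMap he)) (h.trans (map_zero _).symm))
  have hprod := mul_ne_zero (hren _ (Fin.castSucc_injective _)) (hren _ (Fin.succ_injective _))
  obtain ⟨c, hc⟩ : ∃ c : Fin m × Fin (r + 2) × Fin (r + 2) → K,
      MvPolynomial.eval c (MvPolynomial.rename
        (Prod.map id (Prod.map Fin.castSucc Fin.castSucc)) Q *
        MvPolynomial.rename (Prod.map id (Prod.map Fin.succ Fin.succ)) Q) ≠ 0 := by
    by_contra! h
    exact hprod (MvPolynomial.funext fun c => by rw [h c, map_zero])
  rw [map_mul, MvPolynomial.eval_rename, MvPolynomial.eval_rename, hQ, hQ] at hc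
  have hsub : ∀ e : Fin (r + 1) → Fin (r + 2), (∀ i j, e i ≤ e j ↔ i ≤ j) →
      upperTriangularOf (c ∘ Prod.map id (Prod.map e e)) =
        fun l => (upperTriangularOf c l).submatrix e e := by
    intro e he
    ext l i j
    simp [upperTriangularOf, he]
  rw [hsub _ fun _ _ => Fin.castSucc_le_castSucc_iff, hsub _ fun _ _ => Fin.succ_le_succ_iff,
    lift_submatrix_window 0 (by simp) (UT_upperTriangularOf c),
    lift_submatrix_window 1 (by simp [add_comm]) (UT_upperTriangularOf c)] at hc
  exact ⟨upperTriangularOf c, UT_upperTriangularOf c,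
    by simpa using left_ne_zero_of_mul hc, by simpa using right_ne_zero_of_mul hc⟩

/-- The two entries below the corner can be prescribed independently. -/
theorem HasOrder.exists_lift_eq [Infinite K] (hord : HasOrder p r) (hr : 1 ≤ r) (a b : K) :
    ∃ u : Fin m → Matrix (Fin (r + 2)) (Fin (r + 2)) K, (∀ i, UT (u i)) ∧
      FreeAlgebra.lift K u p 0 (Fin.last r).castSucc = a ∧
      FreeAlgebra.lift K u p 1 (Fin.last (r + 1)) = b := by
  obtain ⟨u, hu, h0, h1⟩ := hord.exists_both_ne_zero
  set x := FreeAlgebra.lift K u p 0 (Fin.last r).castSucc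
  set y := FreeAlgebra.lift K u p 1 (Fin.last (r + 1)) with hy
  let w : Fin (r + 2) → Fin (r + 2) → K := fun i j =>
    (if (i : ℕ) = 0 ∧ 0 < (j : ℕ) then a / x else 1) *
      (if (i : ℕ) < r + 1 ∧ (j : ℕ) = r + 1 then b / y else 1)
  refine ⟨fun l => Matrix.of fun i j => w i j * u l i j, fun l i j h => by simp [hu l i j h], ?_⟩
  rw [lift_weight w _ _ hu p]
  · have hr0 : 0 < r := hr
    simp [w, hr0.ne', ← hy, h1, x, div_mul_cancel₀ _ h0]
  · intro i
    have h1 : ¬ ((i : ℕ) = 0 ∧ 0 < (i : ℕ)) := by omega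
    have h2 : ¬ ((i : ℕ) < r + 1 ∧ (i : ℕ) = r + 1) := by omega
    simp only [w, if_neg h1, if_neg h2, mul_one]
  · intro i k j hik hkj
    rw [Fin.le_def] at hik hkj
    have h1 := i.isLt
    have h2 := k.isLt
    have h3 := j.isLt
    simp only [w]
    split_ifs <;> first | omega | ring

theorem HasOrder.exists_corner_eq (hord : HasOrder p r) (hr : 1 ≤ r) (c : K) :
    ∃ u : Fin m → Matrix (Fin (r + 1)) (Fin (r + 1)) K, (∀ i, UT (u i)) ∧
      FreeAlgebra.lift K u p 0 (Fin.last r) = c := by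
  obtain ⟨u, hu, hne⟩ := hord.exists_corner_ne_zero
  let w : Fin (r + 1) → Fin (r + 1) → K := fun i j =>
    if (i : ℕ) = 0 ∧ 0 < (j : ℕ) then c / FreeAlgebra.lift K u p 0 (Fin.last r) else 1
  refine ⟨fun l => Matrix.of fun i j => w i j * u l i j, fun l i j h => by simp [hu l i j h], ?_⟩
  have hr0 : 0 < r := hr
  rw [lift_weight w _ _ hu p]
  · simp [w, hr0.ne', div_mul_cancel₀ _ hne]
  · intro i
    exact if_neg (by omega)
  · intro i k j hik hkj
    rw [Fin.le_def] at hik hkj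
    simp only [w]
    split_ifs <;> first | omega | ring

/-- The corner entry can be prescribed with the two entries next to it zero. -/
theorem HasOrder.exists_lift_corner (hord : HasOrder p r) (hr : 2 ≤ r) (c : K) :
    ∃ u : Fin m → Matrix (Fin (r + 2)) (Fin (r + 2)) K, (∀ i, UT (u i)) ∧
      FreeAlgebra.lift K u p 0 (Fin.last r).castSucc = 0 ∧
      FreeAlgebra.lift K u p 1 (Fin.last (r + 1)) = 0 ∧
      FreeAlgebra.lift K u p 0 (Fin.last (r + 1)) = c := by
  obtain ⟨v, hv, hc⟩ := hord.exists_corner_eq (by omega) c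
  let k : Fin (r + 2) := 1
  have hk : (k : ℕ) = 1 := by simp [k]
  let u : Fin m → Matrix (Fin (r + 2)) (Fin (r + 2)) K := fun l =>
    Matrix.of (Fin.insertNth (α := fun _ => Fin (r + 2) → K) k 0 fun i =>
      Fin.insertNth (α := fun _ => K) k 0 (v l i))
  have hrow : ∀ l j, u l k j = 0 := fun l j => by simp [u]
  have hcol : ∀ l i, u l i k = 0 := fun l i => by
    refine Fin.succAboveCases k ?_ (fun i => ?_) i <;> simp [u]
  have hsub : ∀ l i j, u l (k.succAbove i) (k.succAbove j) = v l i j := fun l i j => by simp [u]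
  have hu : ∀ l, UT (u l) := by
    intro l i j
    refine Fin.succAboveCases k (fun _ => hrow l j) (fun i => ?_) i
    refine Fin.succAboveCases k (fun _ => hcol l _) (fun j h => ?_) j
    rw [hsub]
    exact hv l i j (Fin.succAbove_lt_succAbove_iff.mp h)
  obtain ⟨h1, -, h3⟩ := lift_succAbove k (fun l j _ => hrow l j) (fun l i _ => hcol l i) p
  have hval : ∀ i j, FreeAlgebra.lift K u p (k.succAbove i) (k.succAbove j) =
      FreeAlgebra.lift K v p i j := by
    intro i j
    have : (fun l => (u l).submatrix k.succAbove k.succAbove) = v := by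
      ext l i j
      exact hsub l i j
    rw [← this, h3, Matrix.submatrix_apply]
  have e0 : k.succAbove 0 = 0 := by
    rw [Fin.succAbove_of_castSucc_lt _ _ (by rw [Fin.lt_def]; simp [hk])]
    rfl
  have elast : k.succAbove (Fin.last r) = Fin.last (r + 1) := by
    rw [Fin.succAbove_of_le_castSucc _ _ (by rw [Fin.le_def]; simp [hk]; omega)]
    rfl
  have epred : k.succAbove ⟨r - 1, by omega⟩ = (Fin.last r).castSucc := by
    rw [Fin.succAbove_of_le_castSucc _ _ (by rw [Fin.le_def]; simp [hk]; omega)]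
    ext
    simp
    omega
  refine ⟨u, hu, ?_, h1 _ fun h => ?_, ?_⟩
  · rw [← e0, ← epred, hval]
    exact hord.lift_apply_eq_zero (by omega) hv (by simp; omega)
  · have := congrArg Fin.val h
    simp [hk] at this
    omega
  · rw [← e0, ← elast, hval, hc]

/-- A matrix supported on the last two diagonals is determined by three entries. -/
theorem eq_of_three_entries {A B : Matrix (Fin (r + 2)) (Fin (r + 2)) K}
    (hA : ∀ i j : Fin (r + 2), (j : ℕ) < i + r → A i j = 0)
    (hB : ∀ i j : Fin (r + 2), (j : ℕ) < i + r → B i j = 0)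
    (h0 : A 0 (Fin.last r).castSucc = B 0 (Fin.last r).castSucc)
    (h1 : A 1 (Fin.last (r + 1)) = B 1 (Fin.last (r + 1)))
    (h2 : A 0 (Fin.last (r + 1)) = B 0 (Fin.last (r + 1))) : A = B := by
  ext i j
  by_cases hij : (j : ℕ) < i + r
  · rw [hA i j hij, hB i j hij]
  have hj := j.isLt
  by_cases hi : (i : ℕ) = 0
  · obtain rfl : i = 0 := by ext; simpa using hi
    by_cases hj' : (j : ℕ) = r
    · obtain rfl : j = (Fin.last r).castSucc := by ext; simpa using hj'
      exact h0
    · obtain rfl : j = Fin.last (r + 1) := by ext; simp at hij ⊢; omega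
      exact h2
  · obtain rfl : i = 1 := by ext; simp; omega
    obtain rfl : j = Fin.last (r + 1) := by ext; simp at hij ⊢; omega
    exact h1

/-- Every matrix supported on the last two diagonals is a value of a polynomial of order `r`. -/
theorem HasOrder.exists_lift_eq_of_support [Infinite K] (hord : HasOrder p r) (hr : 2 ≤ r)
    {A : Matrix (Fin (r + 2)) (Fin (r + 2)) K}
    (hA : ∀ i j : Fin (r + 2), (j : ℕ) < i + r → A i j = 0) :
    ∃ u : Fin m → Matrix (Fin (r + 2)) (Fin (r + 2)) K, (∀ i, UT (u i)) ∧
      FreeAlgebra.lift K u p = A := by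
  suffices h : ∃ u : Fin m → Matrix (Fin (r + 2)) (Fin (r + 2)) K, (∀ i, UT (u i)) ∧
      FreeAlgebra.lift K u p 0 (Fin.last r).castSucc = A 0 (Fin.last r).castSucc ∧
      FreeAlgebra.lift K u p 1 (Fin.last (r + 1)) = A 1 (Fin.last (r + 1)) ∧
      FreeAlgebra.lift K u p 0 (Fin.last (r + 1)) = A 0 (Fin.last (r + 1)) by
    obtain ⟨u, hu, h0, h1, h2⟩ := h
    exact ⟨u, hu, eq_of_three_entries
      (fun i j hij => hord.lift_apply_eq_zero (by omega) hu hij) hA h0 h1 h2⟩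
  obtain ⟨u, hu, h0, h1⟩ := hord.exists_lift_eq (by omega : 1 ≤ r)
    (A 0 (Fin.last r).castSucc) (A 1 (Fin.last (r + 1)))
  have hM : FreeAlgebra.lift K u p 1 (Fin.last r).castSucc = 0 :=
    hord.lift_apply_eq_zero (by omega) hu (by simp)
  have hconj : ∀ {i j : Fin (r + 2)} (hij : i < j) (t : K),
      (∀ l, UT (Matrix.transvection i j t * u l * Matrix.transvection i j (-t))) ∧
      FreeAlgebra.lift K
        (fun l => Matrix.transvection i j t * u l * Matrix.transvection i j (-t)) p =
        Matrix.transvection i j t * FreeAlgebra.lift K u p * Matrix.transvection i j (-t) :=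
    fun hij t => ⟨fun l => ((UT.transvection hij t).mul (hu l)).mul (UT.transvection hij _),
      lift_conj (by rw [Matrix.transvection_mul_transvection_same _ _ hij.ne]; simp) u p⟩
  set M := FreeAlgebra.lift K u p
  have n0 : (0 : Fin (r + 2)) ≠ (Fin.last r).castSucc := by
    simp only [ne_eq, Fin.ext_iff]; simp; omega
  have n1 : (1 : Fin (r + 2)) ≠ (Fin.last r).castSucc := by
    simp only [ne_eq, Fin.ext_iff]; simp; omega
  have n2 : (1 : Fin (r + 2)) ≠ Fin.last (r + 1) := by
    simp only [ne_eq, Fin.ext_iff]; simp; omega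
  have n3 : (Fin.last r).castSucc ≠ Fin.last (r + 1) := by
    simp only [ne_eq, Fin.ext_iff]; simp
  have n4 : (0 : Fin (r + 2)) ≠ 1 := by simp
  by_cases ha : A 0 (Fin.last r).castSucc = 0
  · by_cases hb : A 1 (Fin.last (r + 1)) = 0
    · rw [ha, hb]
      exact hord.exists_lift_corner hr _
    · obtain ⟨hw, hlift⟩ := hconj (i := 0) (j := 1) (by simp)
        ((A 0 (Fin.last (r + 1)) - M 0 (Fin.last (r + 1))) / A 1 (Fin.last (r + 1)))
      refine ⟨_, hw, ?_⟩
      rw [hlift, Matrix.mul_transvection_apply_of_ne _ _ _ _ n1.symm,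
        Matrix.mul_transvection_apply_of_ne _ _ _ _ n2.symm,
        Matrix.mul_transvection_apply_of_ne _ _ _ _ n2.symm,
        Matrix.transvection_mul_apply_same, Matrix.transvection_mul_apply_same,
        Matrix.transvection_mul_apply_of_ne _ _ _ _ n4.symm, hM, h0, h1, div_mul_cancel₀ _ hb]
      exact ⟨by simp, rfl, by ring⟩
  · obtain ⟨hw, hlift⟩ := hconj (i := (Fin.last r).castSucc) (j := Fin.last (r + 1))
      (Fin.castSucc_lt_last _)
      (-((A 0 (Fin.last (r + 1)) - M 0 (Fin.last (r + 1))) / A 0 (Fin.last r).castSucc))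
    refine ⟨_, hw, ?_⟩
    rw [hlift, neg_neg, Matrix.mul_transvection_apply_of_ne _ _ _ _ n3,
      Matrix.mul_transvection_apply_same, Matrix.mul_transvection_apply_same,
      Matrix.transvection_mul_apply_of_ne _ _ _ _ n0,
      Matrix.transvection_mul_apply_of_ne _ _ _ _ n0,
      Matrix.transvection_mul_apply_of_ne _ _ _ _ n1,
      Matrix.transvection_mul_apply_of_ne _ _ _ _ n1, hM, h0, h1, div_mul_cancel₀ _ ha]
    exact ⟨rfl, by simp, by ring⟩

end Order

theorem stmt_10 {K : Type*} [Field K] [Infinite K] (m n : ℕ) (hm : 1 ≤ m) (hn : 4 ≤ n)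
    (p : FreeAlgebra K (Fin m)) (hp : ZeroConst p)
    (hord : HasOrder p (n - 2)) :
    ∀ A : Matrix (Fin n) (Fin n) K,
      (∃ u : Fin m → Matrix (Fin n) (Fin n) K, (∀ i, UT (u i)) ∧
        FreeAlgebra.lift K u p = A) ↔
      (∀ i j : Fin n, (j : ℕ) < (i : ℕ) + (n - 2) → A i j = 0) := by
  obtain ⟨r, rfl⟩ : ∃ r, n = r + 2 := ⟨n - 2, by omega⟩
  rw [Nat.add_sub_cancel] at hord
  intro A
  simp only [Nat.add_sub_cancel]
  constructor
  · rintro ⟨u, hu, rfl⟩ i j hij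
    exact hord.lift_apply_eq_zero (by omega) hu hij
  · exact fun hA => hord.exists_lift_eq_of_support (by omega) hA
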